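/- Suppose D ⊆ ℝ × ℝ intersects every line of ℝ² in a set of cardinality at most ℵ₀, and additionally for every line ℓ the set Z_ℓ = {ℓ̂ | ℓ̂ is a line parallel to ℓ and ℓ̂ ∩ D has at least 2 elements} has cardinality 𝔠. Then there exists a Mazurkiewicz set M such that for every line ℓ, the set {ℓ̂ | ℓ̂ is a line parallel to ℓ and M ∩ ℓ̂ ∩ D has exactly 2 elements} has cardinality 𝔠. -/

import Mathlib

open Cardinal Set

noncomputable section

/-- The line through `p` with direction `v`. -/
def lineThrough (p v : ℝ × ℝ) : Set (ℝ × ℝ) := {q | ∃ t : ℝ, q = p + t • v}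

/-- `L` is a straight line of `ℝ²`. -/
def IsLine (L : Set (ℝ × ℝ)) : Prop := ∃ p v : ℝ × ℝ, v ≠ 0 ∧ L = lineThrough p v

/-- `L` is a vertical line of `ℝ²`. -/
def IsVerticalLine (L : Set (ℝ × ℝ)) : Prop := ∃ x : ℝ, L = {p : ℝ × ℝ | p.1 = x}

/-- `L₁` and `L₂` are parallel lines. -/
def ParallelLines (L₁ L₂ : Set (ℝ × ℝ)) : Prop :=
  ∃ (p₁ p₂ v : ℝ × ℝ) (c : ℝ), v ≠ 0 ∧ c ≠ 0 ∧
    L₁ = lineThrough p₁ v ∧ L₂ = lineThrough p₂ (c • v)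

/-- A Mazurkiewicz set meets every line in exactly two points. -/
def IsMazurkiewicz (M : Set (ℝ × ℝ)) : Prop :=
  ∀ L : Set (ℝ × ℝ), IsLine L → (M ∩ L).encard = 2

/-- The graph of a partial function `g` defined on `S ⊆ ℝ`. -/
def graphOn (S : Set ℝ) (g : S → ℝ) : Set (ℝ × ℝ) := {p | ∃ x : S, p = ((x : ℝ), g x)}

/-- The graph of a function `f : ℝ → ℝ`. -/
def graphOf (f : ℝ → ℝ) : Set (ℝ × ℝ) := {p | ∃ x : ℝ, p = (x, f x)}

/-- A Sierpiński–Zygmund set. -/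
def IsSZSet (X : Set (ℝ × ℝ)) : Prop :=
  ∀ (S : Set ℝ) (g : S → ℝ), Continuous g →
    #↥(X ∩ graphOn S g) < Cardinal.continuum

/-- A Sierpiński–Zygmund function. -/
def IsSZFun (f : ℝ → ℝ) : Prop :=
  ∀ (S : Set ℝ) (g : S → ℝ), Continuous g →
    #↥{x : S | f x.1 = g x} < Cardinal.continuum

/-- Rotation about the origin by angle `θ`. -/
def rot (θ : ℝ) (p : ℝ × ℝ) : ℝ × ℝ :=
  (p.1 * Real.cos θ - p.2 * Real.sin θ, p.1 * Real.sin θ + p.2 * Real.cos θ)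

/-- A Hamel basis of `ℝ²`: a basis of `ℝ × ℝ` as a vector space over `ℚ`. -/
def IsHamelBasis (H : Set (ℝ × ℝ)) : Prop :=
  LinearIndependent ℚ ((↑) : H → ℝ × ℝ) ∧ Submodule.span ℚ H = ⊤

/-- A Hamel function: a function whose graph is a Hamel basis of `ℝ²`. -/
def IsHamelFun (h : ℝ → ℝ) : Prop := IsHamelBasis (graphOf h)

/-! ### Lines of the plane -/

theorem mem_lineThrough_left (p v : ℝ × ℝ) : p ∈ lineThrough p v := ⟨0, by simp⟩

theorem lineThrough_eq_of_mem {p q v : ℝ × ℝ} (h : q ∈ lineThrough p v) :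
    lineThrough q v = lineThrough p v := by
  obtain ⟨t, rfl⟩ := h
  ext x
  constructor
  · rintro ⟨s, rfl⟩
    exact ⟨t + s, by module⟩
  · rintro ⟨s, rfl⟩
    exact ⟨s - t, by module⟩

theorem lineThrough_smul (p v : ℝ × ℝ) {c : ℝ} (hc : c ≠ 0) :
    lineThrough p (c • v) = lineThrough p v := by
  ext x
  constructor
  · rintro ⟨s, rfl⟩
    exact ⟨s * c, by rw [mul_smul]⟩
  · rintro ⟨s, rfl⟩
    exact ⟨s / c, by rw [smul_smul, div_mul_cancel₀ _ hc]⟩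

theorem lineThrough_sub_eq {p v a b : ℝ × ℝ} (hab : a ≠ b) (ha : a ∈ lineThrough p v)
    (hb : b ∈ lineThrough p v) : lineThrough a (b - a) = lineThrough p v := by
  rw [← lineThrough_eq_of_mem ha] at hb ⊢
  obtain ⟨t, rfl⟩ := hb
  have ht : t ≠ 0 := by
    rintro rfl
    simp at hab
  rw [add_sub_cancel_left, lineThrough_smul _ _ ht]

theorem isLine_lineThrough_sub {a b : ℝ × ℝ} (hab : a ≠ b) : IsLine (lineThrough a (b - a)) :=
  ⟨a, b - a, sub_ne_zero.2 hab.symm, rfl⟩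

theorem mem_lineThrough_sub (a b : ℝ × ℝ) : b ∈ lineThrough a (b - a) := ⟨1, by simp⟩

theorem lineThrough_sub_self (a : ℝ × ℝ) : lineThrough a (a - a) = {a} := by
  ext x
  simp [lineThrough]

theorem IsLine.eq_lineThrough_sub {L : Set (ℝ × ℝ)} (hL : IsLine L) {a b : ℝ × ℝ} (hab : a ≠ b)
    (ha : a ∈ L) (hb : b ∈ L) : L = lineThrough a (b - a) := by
  obtain ⟨p, v, -, rfl⟩ := hL
  exact (lineThrough_sub_eq hab ha hb).symm

theorem IsLine.eq_of_mem {L K : Set (ℝ × ℝ)} (hL : IsLine L) (hK : IsLine K) {a b : ℝ × ℝ}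
    (hab : a ≠ b) (haL : a ∈ L) (hbL : b ∈ L) (haK : a ∈ K) (hbK : b ∈ K) : L = K :=
  (hL.eq_lineThrough_sub hab haL hbL).trans (hK.eq_lineThrough_sub hab haK hbK).symm

theorem ParallelLines.exists_eq_lineThrough {p v : ℝ × ℝ} {L : Set (ℝ × ℝ)}
    (h : ParallelLines L (lineThrough p v)) : ∃ q, L = lineThrough q v := by
  obtain ⟨p₁, p₂, w, c, hw, hc, rfl, h₂⟩ := h
  rw [lineThrough_smul _ _ hc] at h₂
  have hp : p₂ ∈ lineThrough p v := h₂ ▸ mem_lineThrough_left p₂ w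
  have hpw : p₂ + w ∈ lineThrough p v := h₂ ▸ ⟨1, by simp⟩
  rw [← lineThrough_eq_of_mem hp] at hpw
  obtain ⟨t, ht⟩ := hpw
  obtain rfl : w = t • v := add_left_cancel ht
  exact ⟨p₁, lineThrough_smul _ _ fun h => hw (by rw [h, zero_smul])⟩

/-- Two parallels to the same line with a common point coincide. -/
theorem ParallelLines.eq_of_mem {L K K' : Set (ℝ × ℝ)} (hL : IsLine L) (h : ParallelLines K L)
    (h' : ParallelLines K' L) {x : ℝ × ℝ} (hx : x ∈ K) (hx' : x ∈ K') : K = K' := by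
  obtain ⟨p, v, -, rfl⟩ := hL
  obtain ⟨q, rfl⟩ := h.exists_eq_lineThrough
  obtain ⟨q', rfl⟩ := h'.exists_eq_lineThrough
  rw [← lineThrough_eq_of_mem hx, ← lineThrough_eq_of_mem hx']

theorem mk_isLine_le_continuum : #{L : Set (ℝ × ℝ) | IsLine L} ≤ 𝔠 := by
  have h : {L : Set (ℝ × ℝ) | IsLine L} ⊆
      range fun x : (ℝ × ℝ) × (ℝ × ℝ) => lineThrough x.1 x.2 := by
    rintro L ⟨p, v, -, rfl⟩
    exact ⟨(p, v), rfl⟩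
  refine (mk_le_mk_of_subset h).trans (mk_range_le.trans ?_)
  simp [mk_real]

theorem IsLine.continuum_le_mk {L : Set (ℝ × ℝ)} (hL : IsLine L) : 𝔠 ≤ #L := by
  obtain ⟨p, v, hv, rfl⟩ := hL
  rw [← mk_real]
  refine mk_le_of_injective (f := fun t : ℝ => (⟨p + t • v, t, rfl⟩ : lineThrough p v)) ?_
  intro s t hst
  exact smul_left_injective ℝ hv (add_left_cancel (Subtype.ext_iff.1 hst))

/-! ### Cardinality -/

theorem mk_biUnion_lt_continuum {ι α : Type} {s : Set ι} {f : ι → Set α} (hs : #s < 𝔠)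
    (hf : ∀ i ∈ s, (f i).Countable) : #(⋃ i ∈ s, f i : Set α) < 𝔠 := by
  refine (mk_biUnion_le f s).trans_lt
    (mul_lt_of_lt aleph0_le_continuum hs (lt_of_le_of_lt ?_ aleph0_lt_continuum))
  exact ciSup_le' fun i => (hf i i.2).le_aleph0

/-! ### Sets meeting every line in at most two points -/

/-- `M` meets every line in at most two points. -/
def NoThreeCollinear (M : Set (ℝ × ℝ)) : Prop :=
  ∀ L, IsLine L → ∀ a ∈ M ∩ L, ∀ b ∈ M ∩ L, ∀ c ∈ M ∩ L, a = b ∨ a = c ∨ b = c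

theorem NoThreeCollinear.encard_le {M L A : Set (ℝ × ℝ)} (hM : NoThreeCollinear M)
    (hL : IsLine L) (hA : A ⊆ M ∩ L) : A.encard ≤ 2 := by
  by_contra! h
  obtain ⟨T, hTA, hT⟩ := exists_subset_encard_eq (Order.add_one_le_of_lt h)
  obtain ⟨a, b, c, hab, hac, hbc, rfl⟩ := encard_eq_three.1 (hT.trans (by norm_num))
  have hAM := hTA.trans hA
  rcases hM L hL a (hAM (by simp)) b (hAM (by simp)) c (hAM (by simp)) with h | h | h <;>
    contradiction

theorem NoThreeCollinear.encard_eq_two {M L A : Set (ℝ × ℝ)} (hM : NoThreeCollinear M)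
    (hL : IsLine L) (hA : A ⊆ M ∩ L) (hA' : A.Nontrivial) : A.encard = 2 := by
  refine (hM.encard_le hL hA).antisymm ?_
  rw [← one_add_one_eq_two]
  exact Order.add_one_le_of_lt (one_lt_encard_iff_nontrivial.2 hA')

theorem NoThreeCollinear.insert_of_forall_eq {S : Set (ℝ × ℝ)} (hS : NoThreeCollinear S) {x : ℝ × ℝ}
    (hx : ∀ L, IsLine L → x ∈ L → ∀ a ∈ S ∩ L, ∀ b ∈ S ∩ L, a = b) :
    NoThreeCollinear (insert x S) := by
  have key : ∀ L, IsLine L → x ∈ L → ∀ a ∈ S, a ∈ L → ∀ b ∈ S, b ∈ L → a = b :=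
    fun L hL hxL a ha haL b hb hbL => hx L hL hxL a ⟨ha, haL⟩ b ⟨hb, hbL⟩
  rintro L hL a ⟨rfl | ha, haL⟩ b ⟨rfl | hb, hbL⟩ c ⟨rfl | hc, hcL⟩
  all_goals first
    | exact hS L hL a ⟨ha, haL⟩ b ⟨hb, hbL⟩ c ⟨hc, hcL⟩
    | grind

theorem noThreeCollinear_iUnion {ι : Type} [LinearOrder ι] {s : Set ι} {F G : ι → Set (ℝ × ℝ)}
    (hFG : ∀ i ∈ s, ∀ j ≤ i, F j ⊆ G i) (hG : ∀ i ∈ s, NoThreeCollinear (G i)) :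
    NoThreeCollinear (⋃ i ∈ s, F i) := by
  rintro L hL a ⟨ha, haL⟩ b ⟨hb, hbL⟩ c ⟨hc, hcL⟩
  simp only [mem_iUnion] at ha hb hc
  obtain ⟨i, hi, ha⟩ := ha
  obtain ⟨j, hj, hb⟩ := hb
  obtain ⟨k, hk, hc⟩ := hc
  obtain ⟨m, hm, him, hjm, hkm⟩ : ∃ m ∈ s, i ≤ m ∧ j ≤ m ∧ k ≤ m := by
    rcases le_total i j with h₁ | h₁ <;> rcases le_total j k with h₂ | h₂ <;>
      rcases le_total i k with h₃ | h₃ <;> grind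
  exact hG m hm L hL a ⟨hFG m hm i him ha, haL⟩ b ⟨hFG m hm j hjm hb, hbL⟩
    c ⟨hFG m hm k hkm hc, hcL⟩

/-- The points on lines joining points of `S`, together with `S` itself. -/
def secantSet (S : Set (ℝ × ℝ)) : Set (ℝ × ℝ) :=
  ⋃ x ∈ S ×ˢ S, lineThrough x.1 (x.2 - x.1)

theorem subset_secantSet (S : Set (ℝ × ℝ)) : S ⊆ secantSet S := fun a ha =>
  mem_biUnion (x := (a, a)) ⟨ha, ha⟩ (mem_lineThrough_left _ _)

theorem eq_of_notMem_secantSet {S L : Set (ℝ × ℝ)} {x : ℝ × ℝ} (hx : x ∉ secantSet S)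
    (hL : IsLine L) (hxL : x ∈ L) (a : ℝ × ℝ) (ha : a ∈ S ∩ L) (b : ℝ × ℝ) (hb : b ∈ S ∩ L) :
    a = b := by
  by_contra hab
  refine hx (mem_biUnion (x := (a, b)) ⟨ha.1, hb.1⟩ ?_)
  rwa [← hL.eq_lineThrough_sub hab ha.2 hb.2]

theorem mk_secantSet_inter_lt {S X : Set (ℝ × ℝ)} (hS : #S < 𝔠)
    (hX : ∀ a ∈ S, ∀ b ∈ S, a ≠ b → (lineThrough a (b - a) ∩ X).Countable) :
    #(secantSet S ∩ X : Set (ℝ × ℝ)) < 𝔠 := by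
  rw [secantSet, iUnion₂_inter]
  refine mk_biUnion_lt_continuum ?_ ?_
  · rw [mk_setProd]
    exact mul_lt_of_lt aleph0_le_continuum hS hS
  · rintro ⟨a, b⟩ ⟨ha, hb⟩
    rcases eq_or_ne a b with rfl | hab
    · rw [lineThrough_sub_self]
      exact (countable_singleton a).mono inter_subset_left
    · exact hX a ha b hb hab

/-! ### The extension step -/

theorem NoThreeCollinear.exists_insert {S L : Set (ℝ × ℝ)} (hS : NoThreeCollinear S)
    (hSc : #S < 𝔠) (hL : IsLine L) (hSL : (S ∩ L).Subsingleton) :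
    ∃ x ∈ L, x ∉ S ∧ NoThreeCollinear (insert x S) := by
  have hlt : #(secantSet S ∩ L : Set (ℝ × ℝ)) < #L := by
    refine (mk_secantSet_inter_lt hSc fun a ha b hb hab => ?_).trans_le hL.continuum_le_mk
    refine Set.Subsingleton.countable fun x hx y hy => by_contra fun hxy => hab ?_
    have h := (isLine_lineThrough_sub hab).eq_of_mem hL hxy hx.1 hy.1 hx.2 hy.2
    exact hSL ⟨ha, h ▸ mem_lineThrough_left _ _⟩ ⟨hb, h ▸ mem_lineThrough_sub a b⟩
  obtain ⟨x, hxL, hx⟩ : ∃ x ∈ L, x ∉ secantSet S ∩ L :=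
    not_subset.1 fun h => hlt.not_ge (mk_le_mk_of_subset h)
  have hx' : x ∉ secantSet S := fun h => hx ⟨h, hxL⟩
  exact ⟨x, hxL, fun h => hx' (subset_secantSet S h),
    hS.insert_of_forall_eq fun K hK hxK => eq_of_notMem_secantSet hx' hK hxK⟩

theorem NoThreeCollinear.exists_finite_nontrivial {S L : Set (ℝ × ℝ)} (hS : NoThreeCollinear S)
    (hSc : #S < 𝔠) (hL : IsLine L) :
    ∃ F : Set (ℝ × ℝ), F.Finite ∧ NoThreeCollinear (S ∪ F) ∧ ((S ∪ F) ∩ L).Nontrivial := by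
  have key : ∀ {T : Set (ℝ × ℝ)}, NoThreeCollinear T → #T < 𝔠 → (T ∩ L).Nonempty →
      ∃ x, NoThreeCollinear (insert x T) ∧ (insert x T ∩ L).Nontrivial := by
    rintro T hT hTc ⟨a, haT, haL⟩
    by_cases h : (T ∩ L).Nontrivial
    · exact ⟨a, by rwa [insert_eq_of_mem haT], by rwa [insert_eq_of_mem haT]⟩
    · obtain ⟨x, hxL, hxT, hx⟩ := hT.exists_insert hTc hL (not_nontrivial_iff.1 h)
      exact ⟨x, hx, x, ⟨mem_insert x T, hxL⟩, a, ⟨mem_insert_of_mem x haT, haL⟩,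
        fun h => hxT (h ▸ haT)⟩
  by_cases h : (S ∩ L).Nonempty
  · obtain ⟨x, hx⟩ := key hS hSc h
    exact ⟨{x}, finite_singleton x, by rwa [union_singleton]⟩
  · obtain ⟨y, hyL, -, hy⟩ := hS.exists_insert hSc hL
      (by rw [not_nonempty_iff_eq_empty.1 h]; exact subsingleton_empty)
    have hyc : #(insert y S : Set (ℝ × ℝ)) < 𝔠 :=
      mk_insert_le.trans_lt (add_lt_of_lt aleph0_le_continuum hSc
        (one_lt_aleph0.trans aleph0_lt_continuum))
    obtain ⟨x, hx⟩ := key hy hyc ⟨y, mem_insert y S, hyL⟩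
    exact ⟨{x, y}, toFinite _, by rwa [union_insert, union_singleton]⟩

theorem NoThreeCollinear.exists_parallel {D S L : Set (ℝ × ℝ)}
    (hD : ∀ L : Set (ℝ × ℝ), IsLine L → #↥(D ∩ L) ≤ ℵ₀) (hL : IsLine L)
    (hZ : #↥{L' : Set (ℝ × ℝ) | IsLine L' ∧ ParallelLines L' L ∧ 2 ≤ (L' ∩ D).encard} = 𝔠)
    (hS : NoThreeCollinear S) (hSc : #S < 𝔠) :
    ∃ F : Set (ℝ × ℝ), F.Finite ∧ NoThreeCollinear (S ∪ F) ∧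
      ∃ L', IsLine L' ∧ ParallelLines L' L ∧ Disjoint L' S ∧ (F ∩ L' ∩ D).Nontrivial := by
  let B : Set (ℝ × ℝ) := S ∪ secantSet S ∩ D
  have hBc : #B < 𝔠 := by
    refine (mk_union_le _ _).trans_lt (add_lt_of_lt aleph0_le_continuum hSc
      (mk_secantSet_inter_lt hSc fun a _ b _ hab => ?_))
    rw [inter_comm, ← le_aleph0_iff_set_countable]
    exact hD _ (isLine_lineThrough_sub hab)
  obtain ⟨L', ⟨hL', hpar, htwo⟩, hdisj⟩ : ∃ L' ∈ {L' : Set (ℝ × ℝ) |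
      IsLine L' ∧ ParallelLines L' L ∧ 2 ≤ (L' ∩ D).encard}, Disjoint L' B := by
    by_contra! h
    have h' : ∀ K : {L' : Set (ℝ × ℝ) | IsLine L' ∧ ParallelLines L' L ∧ 2 ≤ (L' ∩ D).encard},
        ∃ x : B, x.1 ∈ K.1 := fun K => by
      obtain ⟨x, hxK, hxB⟩ := not_disjoint_iff.1 (h K.1 K.2)
      exact ⟨⟨x, hxB⟩, hxK⟩
    choose f hf using h'
    refine hBc.not_ge (hZ ▸ mk_le_of_injective (f := f) fun K K' hKK' => ?_)
    exact Subtype.ext (ParallelLines.eq_of_mem hL K.2.2.1 K'.2.2.1 (hf K) (hKK' ▸ hf K'))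
  obtain ⟨a, ⟨haL, haD⟩, b, ⟨hbL, hbD⟩, hab⟩ : (L' ∩ D).Nontrivial :=
    one_lt_encard_iff_nontrivial.1 (lt_of_lt_of_le (by norm_num) htwo)
  have hdisjS : Disjoint L' S := hdisj.mono_right subset_union_left
  have hsec : ∀ x ∈ L', x ∈ D → x ∉ secantSet S := fun x hxL hxD hx =>
    disjoint_left.1 hdisj hxL (Or.inr ⟨hx, hxD⟩)
  have ha : NoThreeCollinear (insert a S) :=
    hS.insert_of_forall_eq fun K hK haK => eq_of_notMem_secantSet (hsec a haL haD) hK haK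
  have hb : NoThreeCollinear (insert b (insert a S)) := by
    have key : ∀ K, IsLine K → b ∈ K → a ∈ K → ∀ s ∈ S, s ∉ K := by
      intro K hK hbK haK s hs hsK
      obtain rfl := hK.eq_of_mem hL' hab haK hbK haL hbL
      exact disjoint_left.1 hdisjS hsK hs
    refine ha.insert_of_forall_eq ?_
    rintro K hK hbK c ⟨rfl | hc, hcK⟩ d ⟨rfl | hd, hdK⟩
    · rfl
    · exact (key K hK hbK hcK d hd hdK).elim
    · exact (key K hK hbK hdK c hc hcK).elim
    · exact eq_of_notMem_secantSet (hsec b hbL hbD) hK hbK c ⟨hc, hcK⟩ d ⟨hd, hdK⟩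
  refine ⟨{b, a}, toFinite _, by rwa [union_insert, union_singleton], L', hL', hpar, hdisjS,
    a, ⟨⟨by simp, haL⟩, haD⟩, b, ⟨⟨by simp, hbL⟩, hbD⟩, hab⟩

/-- The finite set `F` prolongs `S` so that `L` gets two points of the union and some parallel
to `L` missing `S` gets two points of `F ∩ D`. -/
def IsExtension (D L S F : Set (ℝ × ℝ)) : Prop :=
  F.Finite ∧ NoThreeCollinear (S ∪ F) ∧ ((S ∪ F) ∩ L).Nontrivial ∧
    ∃ L', IsLine L' ∧ ParallelLines L' L ∧ Disjoint L' S ∧ (F ∩ L' ∩ D).Nontrivial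

theorem NoThreeCollinear.exists_isExtension {D S L : Set (ℝ × ℝ)}
    (hD : ∀ L : Set (ℝ × ℝ), IsLine L → #↥(D ∩ L) ≤ ℵ₀) (hL : IsLine L)
    (hZ : #↥{L' : Set (ℝ × ℝ) | IsLine L' ∧ ParallelLines L' L ∧ 2 ≤ (L' ∩ D).encard} = 𝔠)
    (hS : NoThreeCollinear S) (hSc : #S < 𝔠) : ∃ F, IsExtension D L S F := by
  obtain ⟨F, hF, hSF, L', hL', hpar, hdisj, hnt⟩ := hS.exists_parallel hD hL hZ hSc
  have hSFc : #(S ∪ F : Set (ℝ × ℝ)) < 𝔠 := (mk_union_le _ _).trans_lt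
    (add_lt_of_lt aleph0_le_continuum hSc (hF.lt_aleph0.trans aleph0_lt_continuum))
  obtain ⟨G, hG, hSG, hntG⟩ := hSF.exists_finite_nontrivial hSFc hL
  rw [union_assoc] at hSG hntG
  exact ⟨F ∪ G, hF.union hG, hSG, hntG, L', hL', hpar, hdisj,
    hnt.mono fun x hx => ⟨⟨Or.inl hx.1.1, hx.1.2⟩, hx.2⟩⟩

/-! ### Transfinite recursion -/

theorem exists_eq_biUnion_Iio {ι α : Type} [LinearOrder ι] [WellFoundedLT ι]
    (G : ι → Set α → Set α) : ∃ F : ι → Set α, ∀ i, F i = G i (⋃ j ∈ Iio i, F j) := by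
  refine ⟨(wellFounded_lt (α := ι)).fix fun i F => G i (⋃ j, ⋃ h : j < i, F j h), fun i => ?_⟩
  rw [WellFounded.fix_eq]
  rfl

/-- Finite extensions along a well-order with small initial segments stay free of collinear
triples. -/
theorem exists_isExtension_family {ι : Type} [LinearOrder ι] [WellFoundedLT ι]
    (hι : ∀ i : ι, #(Iio i) < 𝔠) {D : Set (ℝ × ℝ)} {L : ι → Set (ℝ × ℝ)}
    (hext : ∀ i S, NoThreeCollinear S → #S < 𝔠 → ∃ F, IsExtension D (L i) S F) :
    ∃ F : ι → Set (ℝ × ℝ), NoThreeCollinear (⋃ i, F i) ∧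
      ∀ i, IsExtension D (L i) (⋃ j ∈ Iio i, F j) (F i) := by
  have hG : ∀ i S, ∃ F, NoThreeCollinear S → #S < 𝔠 → IsExtension D (L i) S F := by
    intro i S
    by_cases h : NoThreeCollinear S ∧ #S < 𝔠
    · obtain ⟨F, hF⟩ := hext i S h.1 h.2
      exact ⟨F, fun _ _ => hF⟩
    · exact ⟨∅, fun h₁ h₂ => (h ⟨h₁, h₂⟩).elim⟩
  choose G hG using hG
  obtain ⟨F, hF⟩ := exists_eq_biUnion_Iio G
  have hmono : ∀ i, ∀ j ≤ i, F j ⊆ (⋃ k ∈ Iio i, F k) ∪ F i := by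
    intro i j hji
    rcases hji.eq_or_lt with rfl | hji
    · exact subset_union_right
    · exact (subset_biUnion_of_mem (u := F) (mem_Iio.2 hji)).trans subset_union_left
  have hmain : ∀ i, IsExtension D (L i) (⋃ j ∈ Iio i, F j) (F i) := by
    intro i
    induction i using WellFoundedLT.induction with
    | ind i ih =>
      have h := hG i (⋃ j ∈ Iio i, F j)
        (noThreeCollinear_iUnion (fun j _ => hmono j) fun j hj => (ih j hj).2.1)
        (mk_biUnion_lt_continuum (hι i) fun j hj => (ih j hj).1.countable)
      rwa [← hF i] at h
  refine ⟨F, ?_, hmain⟩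
  rw [← biUnion_univ]
  exact noThreeCollinear_iUnion (fun j _ => hmono j) fun j _ => (hmain j).2.1

/-- If `D` meets every line in an at most countable set and, for every line `ℓ`,
`𝔠`-many lines parallel to `ℓ` meet `D` in at least two points, then there is a
Mazurkiewicz set `M` such that for every line `ℓ`, `𝔠`-many lines parallel to `ℓ`
meet `M ∩ D` in exactly two points. -/
theorem stmt_7 (D : Set (ℝ × ℝ))
    (hD : ∀ L : Set (ℝ × ℝ), IsLine L → #↥(D ∩ L) ≤ Cardinal.aleph0)
    (hZ : ∀ L : Set (ℝ × ℝ), IsLine L →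
      #↥{L' : Set (ℝ × ℝ) | IsLine L' ∧ ParallelLines L' L ∧ 2 ≤ (L' ∩ D).encard}
        = Cardinal.continuum) :
    ∃ M : Set (ℝ × ℝ), IsMazurkiewicz M ∧
      ∀ L : Set (ℝ × ℝ), IsLine L →
        #↥{L' : Set (ℝ × ℝ) | IsLine L' ∧ ParallelLines L' L ∧ (M ∩ L' ∩ D).encard = 2}
          = Cardinal.continuum := by
  let T := {x : (ℝ × ℝ) × (ℝ × ℝ) // x.2 ≠ 0} × ℝ
  have hT : #T ≤ 𝔠 := by
    refine (mk_le_of_injective (Subtype.val_injective.prodMap Function.injective_id)).trans ?_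
    simp [mk_real]
  -- A bare copy of `T`, so that the well-order does not compete with the product order.
  obtain ⟨ι, ⟨e⟩⟩ : ∃ ι : Type, Nonempty (ι ≃ T) := ⟨T, ⟨Equiv.refl T⟩⟩
  let line (i : ι) : Set (ℝ × ℝ) := lineThrough (e i).1.1.1 (e i).1.1.2
  have hline (i : ι) : IsLine (line i) := ⟨_, _, (e i).1.2, rfl⟩
  obtain ⟨_, _, hord⟩ := exists_ord_eq_type_lt ι
  obtain ⟨F, hM, hF⟩ := exists_isExtension_family (L := line)
    (fun i => (mk_Iio_lt i hord).trans_le (e.cardinal_eq.trans_le hT))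
    fun i S hS hSc => hS.exists_isExtension hD (hline i) (hZ _ (hline i)) hSc
  have hsub (i : ι) : F i ⊆ ⋃ j, F j := subset_iUnion F i
  refine ⟨⋃ i, F i, fun L hL => ?_, fun L hL => ?_⟩
  · obtain ⟨p, v, hv, rfl⟩ := hL
    obtain ⟨i, hi⟩ := e.surjective (⟨(p, v), hv⟩, 0)
    have hiL : line i = lineThrough p v := by simp only [line, hi]
    rw [← hiL]
    refine hM.encard_eq_two (hline i) subset_rfl
      ((hF i).2.2.1.mono (inter_subset_inter_left _ ?_))
    exact union_subset (iUnion₂_subset fun j _ => hsub j) (hsub i)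
  · refine ((mk_le_mk_of_subset fun _ h => h.1).trans mk_isLine_le_continuum).antisymm ?_
    obtain ⟨p, v, hv, rfl⟩ := hL
    let i (r : ℝ) : ι := e.symm (⟨(p, v), hv⟩, r)
    have hiL (r : ℝ) : line (i r) = lineThrough p v := by simp [line, i]
    choose K hK hpar hdisj hnt using fun r => hiL r ▸ (hF (i r)).2.2.2
    have hne (r s : ℝ) (hrs : i r < i s) : K r ≠ K s := by
      intro h
      obtain ⟨x, ⟨hxF, hxK⟩, -⟩ := (hnt r).nonempty
      exact disjoint_left.1 (hdisj s) (h ▸ hxK) (mem_biUnion (mem_Iio.2 hrs) hxF)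
    rw [← mk_real]
    refine mk_le_of_injective (f := fun r => ⟨K r, hK r, hpar r, ?_⟩) fun r s hrs => ?_
    · refine hM.encard_eq_two (hK r) inter_subset_left ((hnt r).mono ?_)
      exact inter_subset_inter_left _ (inter_subset_inter_left _ (hsub (i r)))
    · have hK' : K r = K s := Subtype.ext_iff.1 hrs
      rcases lt_trichotomy (i r) (i s) with h | h | h
      · exact (hne r s h hK').elim
      · exact congrArg Prod.snd (e.symm.injective h)
      · exact (hne s r h hK'.symm).elim
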